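/- arXiv:2406.05583 — 6 statements merged into one kernel-verified Lean document; each statement's English description precedes it below -/
import Mathlib

section
/- There exist a continuous surjection F : [0,1] → [0,1] × [0,1] and, for every k ∈ ℕ, finite families of sets I^k_1, …, I^k_{fib(k+2)²} ⊆ [0,1] and J^k_1, …, J^k_{fib(k+2)²} ⊆ [0,1] × [0,1] such that: (i) each I^k_i is a closed interval of positive length, the intervals I^k_1, …, I^k_{fib(k+2)²} have pairwise disjoint interiors, their union is [0,1], and they are ordered consecutively, i.e. max I^k_i = min I^k_{i+1} for 1 ≤ i < fib(k+2)²; (ii) each J^k_i is a closed axis-parallel rectangle (a product of two closed intervals) each of whose two side lengths belongs to {φ^{-(k+1)}, φ^{-k}}, the rectangles J^k_1, …, J^k_{fib(k+2)²} have pairwise disjoint interiors and their union is [0,1] × [0,1]; (iii) the length of I^k_i equals the area of J^k_i for every i; (iv) F maps I^k_i onto J^k_i for every i; and (v) for every 1 ≤ i < fib(k+2)², the intersection J^k_i ∩ J^k_{i+1} contains a line segment of positive length (consecutive rectangles share part of an edge, i.e., the curve is a connected space-filling curve). -/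
open Set MeasureTheory

/-- The golden ratio `φ = (1 + √5)/2`. -/
noncomputable def goldenRatio' : ℝ := (1 + Real.sqrt 5) / 2

namespace FibCurve

noncomputable def tau : ℝ := goldenRatio'⁻¹

lemma gr_pos : 0 < goldenRatio' := by unfold goldenRatio'; positivity

lemma gr_sq : goldenRatio' ^ 2 = goldenRatio' + 1 := by
  unfold goldenRatio'
  have := Real.sq_sqrt (show (0:ℝ) ≤ 5 by norm_num)
  nlinarith

lemma tau_pos : 0 < tau := inv_pos.mpr gr_pos

lemma tau_sq : tau ^ 2 = 1 - tau := by
  have h := gr_sq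
  have h0 := gr_pos.ne'
  unfold tau
  field_simp
  linarith

lemma tau_lt_one : tau < 1 := by
  have := tau_sq
  have := tau_pos
  nlinarith

noncomputable def mid (a b : ℝ) : ℝ := a + tau * (b - a)

lemma mid_sub_left (a b : ℝ) : mid a b - a = tau * (b - a) := by unfold mid; ring
lemma sub_mid (a b : ℝ) : b - mid a b = tau ^ 2 * (b - a) := by
  rw [tau_sq]; unfold mid; ring

lemma abs_mid_left (a b : ℝ) : |mid a b - a| = tau * |b - a| := by
  rw [mid_sub_left, abs_mul, abs_of_pos tau_pos]
lemma abs_mid_right (a b : ℝ) : |b - mid a b| = tau ^ 2 * |b - a| := by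
  rw [sub_mid, abs_mul, abs_of_pos (pow_pos tau_pos 2)]
lemma abs_mid_left' (a b : ℝ) : |a - mid a b| = tau * |b - a| := by
  rw [abs_sub_comm, abs_mid_left]
lemma abs_mid_right' (a b : ℝ) : |mid a b - b| = tau ^ 2 * |b - a| := by
  rw [abs_sub_comm, abs_mid_right]

lemma mid_mem (a b : ℝ) : mid a b ∈ uIcc a b := by
  have h1 := mid_sub_left a b
  have h2 := sub_mid a b
  have := tau_pos
  have := pow_pos tau_pos 2
  rw [mem_uIcc]
  rcases le_total a b with h | h
  · left; constructor <;> nlinarith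
  · right; constructor <;> nlinarith

lemma uIcc_union (a b : ℝ) : uIcc a (mid a b) ∪ uIcc (mid a b) b = uIcc a b := by
  have h := mid_mem a b
  ext z
  simp only [mem_union, mem_uIcc] at *
  constructor
  · rintro ((⟨h1, h2⟩ | ⟨h1, h2⟩) | (⟨h1, h2⟩ | ⟨h1, h2⟩)) <;> rcases h with ⟨h3, h4⟩ | ⟨h3, h4⟩ <;>
      first
      | (left; constructor <;> linarith)
      | (right; constructor <;> linarith)
  · rintro (⟨h1, h2⟩ | ⟨h1, h2⟩) <;> rcases le_total z (mid a b) with h5 | h5 <;>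
      rcases h with ⟨h3, h4⟩ | ⟨h3, h4⟩ <;>
      first
      | (left; left; constructor <;> linarith)
      | (left; right; constructor <;> linarith)
      | (right; left; constructor <;> linarith)
      | (right; right; constructor <;> linarith)

lemma disj_mid (a b : ℝ) :
    Disjoint (interior (uIcc a (mid a b))) (interior (uIcc (mid a b) b)) := by
  have h := mid_mem a b
  rw [Set.disjoint_left]
  intro z hz hz'
  rw [mem_uIcc] at h
  simp only [uIcc, interior_Icc, mem_Ioo, inf_lt_iff, lt_sup_iff] at hz hz'
  rcases hz with ⟨h1 | h1, h2 | h2⟩ <;> rcases hz' with ⟨h3 | h3, h4 | h4⟩ <;>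
    rcases h with ⟨h5, h6⟩ | ⟨h5, h6⟩ <;> linarith

inductive Kind
  | QH | QV | qH | qV | RH | RV

structure Tile where
  kind : Kind
  x0 : ℝ
  x1 : ℝ
  y0 : ℝ
  y1 : ℝ
  s : ℝ
  e : ℝ

open Kind

noncomputable def children : Tile → List Tile
  | ⟨QH, x0, x1, y0, y1, s, e⟩ =>
    [⟨QV, x0, mid x0 x1, y0, mid y0 y1, s, mid s (mid s e)⟩,
     ⟨RH, x0, mid x0 x1, mid y0 y1, y1, mid s (mid s e), mid s e⟩,
     ⟨qV, mid x0 x1, x1, y1, mid y0 y1, mid s e, mid e (mid s e)⟩,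
     ⟨RV, mid x0 x1, x1, mid y0 y1, y0, mid e (mid s e), e⟩]
  | ⟨QV, x0, x1, y0, y1, s, e⟩ =>
    [⟨QH, x0, mid x0 x1, y0, mid y0 y1, s, mid s (mid s e)⟩,
     ⟨RV, mid x0 x1, x1, y0, mid y0 y1, mid s (mid s e), mid s e⟩,
     ⟨qH, x1, mid x0 x1, mid y0 y1, y1, mid s e, mid e (mid s e)⟩,
     ⟨RH, mid x0 x1, x0, mid y0 y1, y1, mid e (mid s e), e⟩]
  | ⟨qH, x0, x1, y0, y1, s, e⟩ => [⟨QH, x0, x1, y0, y1, s, e⟩]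
  | ⟨qV, x0, x1, y0, y1, s, e⟩ => [⟨QV, x0, x1, y0, y1, s, e⟩]
  | ⟨RH, x0, x1, y0, y1, s, e⟩ =>
    [⟨QH, x0, mid x0 x1, y0, y1, s, mid s e⟩,
     ⟨RV, mid x0 x1, x1, y0, y1, mid s e, e⟩]
  | ⟨RV, x0, x1, y0, y1, s, e⟩ =>
    [⟨QV, x0, x1, y0, mid y0 y1, s, mid s e⟩,
     ⟨RH, x0, x1, mid y0 y1, y1, mid s e, e⟩]

def cell (t : Tile) : Set (ℝ × ℝ) := uIcc t.x0 t.x1 ×ˢ uIcc t.y0 t.y1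

/-- exit corner and its opposite corner -/
def ex : Tile → ℝ
  | ⟨QH, _, x1, _, _, _, _⟩ => x1
  | ⟨qH, _, x1, _, _, _, _⟩ => x1
  | ⟨QV, x0, _, _, _, _, _⟩ => x0
  | ⟨qV, x0, _, _, _, _, _⟩ => x0
  | ⟨RH, _, x1, _, _, _, _⟩ => x1
  | ⟨RV, _, x1, _, _, _, _⟩ => x1
def ox : Tile → ℝ
  | ⟨QH, x0, _, _, _, _, _⟩ => x0
  | ⟨qH, x0, _, _, _, _, _⟩ => x0
  | ⟨QV, _, x1, _, _, _, _⟩ => x1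
  | ⟨qV, _, x1, _, _, _, _⟩ => x1
  | ⟨RH, x0, _, _, _, _, _⟩ => x0
  | ⟨RV, x0, _, _, _, _, _⟩ => x0
def ey : Tile → ℝ
  | ⟨QH, _, _, y0, _, _, _⟩ => y0
  | ⟨qH, _, _, y0, _, _, _⟩ => y0
  | ⟨QV, _, _, _, y1, _, _⟩ => y1
  | ⟨qV, _, _, _, y1, _, _⟩ => y1
  | ⟨RH, _, _, _, y1, _, _⟩ => y1
  | ⟨RV, _, _, _, y1, _, _⟩ => y1
def oy : Tile → ℝ
  | ⟨QH, _, _, _, y1, _, _⟩ => y1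
  | ⟨qH, _, _, _, y1, _, _⟩ => y1
  | ⟨QV, _, _, y0, _, _, _⟩ => y0
  | ⟨qV, _, _, y0, _, _, _⟩ => y0
  | ⟨RH, _, _, y0, _, _, _⟩ => y0
  | ⟨RV, _, _, y0, _, _, _⟩ => y0

lemma cell_eq (t : Tile) : cell t = uIcc (ex t) (ox t) ×ˢ uIcc (ey t) (oy t) := by
  rcases t with ⟨k, _, _, _, _, _, _⟩
  cases k <;> simp [cell, ex, ox, ey, oy, uIcc_comm]

def Rel (t t' : Tile) : Prop :=
  t.e = t'.s ∧ ex t = t'.x0 ∧ ey t = t'.y0 ∧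
    (0 < (ox t - ex t) * (t'.x1 - t'.x0) ∨ 0 < (oy t - ey t) * (t'.y1 - t'.y0))

noncomputable def wid (k : ℕ) : Kind → ℝ
  | QH => tau ^ k
  | QV => tau ^ k
  | qH => tau ^ (k + 1)
  | qV => tau ^ (k + 1)
  | RH => tau ^ k
  | RV => tau ^ (k + 1)

noncomputable def hei (k : ℕ) : Kind → ℝ
  | QH => tau ^ k
  | QV => tau ^ k
  | qH => tau ^ (k + 1)
  | qV => tau ^ (k + 1)
  | RH => tau ^ (k + 1)
  | RV => tau ^ k

def WF (k : ℕ) (t : Tile) : Prop :=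
  |t.x1 - t.x0| = wid k t.kind ∧ |t.y1 - t.y0| = hei k t.kind ∧
    t.e - t.s = wid k t.kind * hei k t.kind

lemma wid_pos (k : ℕ) (c : Kind) : 0 < wid k c := by
  have := tau_pos
  cases c <;> simp only [wid] <;> positivity
lemma hei_pos (k : ℕ) (c : Kind) : 0 < hei k c := by
  have := tau_pos
  cases c <;> simp only [hei] <;> positivity
lemma wid_or (k : ℕ) (c : Kind) : wid k c = tau ^ (k+1) ∨ wid k c = tau ^ k := by
  cases c <;> simp [wid]
lemma hei_or (k : ℕ) (c : Kind) : hei k c = tau ^ (k+1) ∨ hei k c = tau ^ k := by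
  cases c <;> simp [hei]
lemma wid_le (k : ℕ) (c : Kind) : wid k c ≤ tau ^ k := by
  rcases wid_or k c with h | h <;> rw [h]
  exact pow_le_pow_of_le_one tau_pos.le tau_lt_one.le (Nat.le_succ k)
lemma hei_le (k : ℕ) (c : Kind) : hei k c ≤ tau ^ k := by
  rcases hei_or k c with h | h <;> rw [h]
  exact pow_le_pow_of_le_one tau_pos.le tau_lt_one.le (Nat.le_succ k)

lemma WF.lt {k : ℕ} {t : Tile} (h : WF k t) : t.s < t.e := by
  have := mul_pos (wid_pos k t.kind) (hei_pos k t.kind)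
  have := h.2.2
  linarith

lemma WF.x_ne {k : ℕ} {t : Tile} (h : WF k t) : t.x1 - t.x0 ≠ 0 := by
  have := wid_pos k t.kind
  rw [← h.1] at this
  exact abs_pos.mp this
lemma WF.y_ne {k : ℕ} {t : Tile} (h : WF k t) : t.y1 - t.y0 ≠ 0 := by
  have := hei_pos k t.kind
  rw [← h.2.1] at this
  exact abs_pos.mp this

lemma mid1 (s e : ℝ) : mid s (mid s e) - s = tau^2 * (e - s) := by unfold mid; ring
lemma mid2 (s e : ℝ) : mid s e - mid s (mid s e) = tau^3 * (e - s) := by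
  rw [sub_mid, mid_sub_left]; ring
lemma mid3 (s e : ℝ) : mid e (mid s e) - mid s e = tau^4 * (e - s) := by
  have h1 := sub_mid e (mid s e)
  have h2 := sub_mid s e
  linear_combination (-1) * h1 + tau^2 * h2
lemma mid4 (s e : ℝ) : e - mid e (mid s e) = tau^3 * (e - s) := by
  have h1 := mid_sub_left e (mid s e)
  have h2 := sub_mid s e
  linear_combination (-1) * h1 + tau * h2

lemma WF.children {k : ℕ} {t : Tile} (h : WF k t) : ∀ c ∈ children t, WF (k+1) c := by
  rcases t with ⟨K, x0, x1, y0, y1, s, e⟩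
  obtain ⟨h1, h2, h3⟩ := h
  cases K <;> simp only [wid, hei] at h1 h2 h3 <;>
  simp only [FibCurve.children, List.mem_cons, List.not_mem_nil, or_false, forall_eq_or_imp, forall_eq,
    WF, wid, hei, abs_mid_left, abs_mid_right, abs_mid_left', abs_mid_right', mid1, mid2, mid3, mid4,
    h1, h2, h3] <;> (try simp only [mid_sub_left, sub_mid, h3]) <;> (repeat' refine And.intro ?_ ?_) <;> first | trivial | ring

lemma mid_time {s e : ℝ} (h : s ≤ e) : s ≤ mid s e ∧ mid s e ≤ e := by
  have := mid_mem s e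
  rwa [uIcc_of_le h] at this
lemma mid_time' {s e : ℝ} (h : s ≤ e) : s ≤ mid e s ∧ mid e s ≤ e := by
  have := mid_mem e s
  rwa [uIcc_of_ge h] at this

lemma children_time {t : Tile} (h : t.s ≤ t.e) : ∀ c ∈ children t, Icc c.s c.e ⊆ Icc t.s t.e := by
  rcases t with ⟨K, x0, x1, y0, y1, s, e⟩
  simp only at h
  obtain ⟨a1, a2⟩ := mid_time h
  obtain ⟨a3, a4⟩ := mid_time a1
  obtain ⟨a5, a6⟩ := mid_time' a2
  cases K <;>
  simp only [children, List.mem_cons, List.not_mem_nil, or_false, forall_eq_or_imp, forall_eq] <;>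
  (repeat' constructor) <;> apply Icc_subset_Icc <;> linarith

lemma children_time_cover {t : Tile} {z : ℝ} (h : z ∈ Icc t.s t.e) :
    ∃ c ∈ children t, z ∈ Icc c.s c.e := by
  rcases t with ⟨K, x0, x1, y0, y1, s, e⟩
  simp only [mem_Icc] at h
  obtain ⟨h1, h2⟩ := h
  cases K <;>
  simp only [children, List.mem_cons, List.not_mem_nil, or_false, exists_eq_or_imp, exists_eq_left, mem_Icc] <;>
  rcases le_total z (mid s e) with a | a <;> rcases le_total z (mid s (mid s e)) with b | b <;>
  rcases le_total z (mid e (mid s e)) with c | c <;> simp [*]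

lemma children_cell_mem {t : Tile} {z : ℝ × ℝ} :
    z ∈ cell t ↔ ∃ c ∈ children t, z ∈ cell c := by
  rcases t with ⟨K, x0, x1, y0, y1, s, e⟩
  have hx := uIcc_union x0 x1
  have hy := uIcc_union y0 y1
  cases K <;>
  simp only [children, cell, List.mem_cons, List.not_mem_nil, or_false, exists_eq_or_imp, exists_eq_left,
    mem_prod, ← hx, ← hy, mem_union, uIcc_comm x1 (mid x0 x1), uIcc_comm y1 (mid y0 y1),
    uIcc_comm (mid x0 x1) x0, uIcc_comm (mid y0 y1) y0] <;> tauto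

lemma children_cell {t : Tile} : ∀ c ∈ children t, cell c ⊆ cell t :=
  fun c hc _ hz => children_cell_mem.2 ⟨c, hc, hz⟩

def Dis (t t' : Tile) : Prop := Disjoint (interior (cell t)) (interior (cell t'))

lemma dis_of (A B C D : Set ℝ) (h : Disjoint (interior A) (interior B) ∨ Disjoint (interior C) (interior D)) :
    Disjoint (interior (A ×ˢ C)) (interior (B ×ˢ D)) := by
  rw [interior_prod_eq, interior_prod_eq]
  exact Set.disjoint_prod.2 h

lemma children_dis (t : Tile) : (children t).Pairwise Dis := by
  rcases t with ⟨K, x0, x1, y0, y1, s, e⟩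
  have hx := disj_mid x0 x1
  have hy := disj_mid y0 y1
  have hx' := hx.symm
  have hy' := hy.symm
  cases K <;>
  simp only [children, Dis, cell, List.pairwise_cons, List.mem_cons, List.not_mem_nil, or_false,
    forall_eq_or_imp, forall_eq, uIcc_comm x1 (mid x0 x1), uIcc_comm y1 (mid y0 y1),
    uIcc_comm (mid x0 x1) x0, uIcc_comm (mid y0 y1) y0, false_imp_iff, implies_true, List.Pairwise.nil,
    and_true] <;> (repeat' constructor) <;> apply dis_of <;> tauto

lemma prod_pos_of {a b : ℝ} (h : a ≠ 0) (c d : ℝ) (hc : 0 < c) (hd : 0 < d) (hb : b = c * d * a ^ 2) : 0 < b := by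
  rw [hb]; positivity

lemma children_chain {k : ℕ} {t : Tile} (h : WF k t) : (children t).IsChain Rel := by
  have hx := h.x_ne
  have hy := h.y_ne
  rcases t with ⟨K, x0, x1, y0, y1, s, e⟩
  simp only at hx hy
  have hx2 : 0 < (x1 - x0)^2 := by positivity
  have hy2 : 0 < (y1 - y0)^2 := by positivity
  have t1 := tau_pos
  have t2 := tau_lt_one
  have X1 : 0 < (mid x0 x1 - x0) * (mid x0 x1 - x0) := by
    rw [mid_sub_left]; have : 0 < tau * tau * (x1-x0)^2 := by positivity
    linarith
  have X2 : 0 < (mid x0 x1 - x1) * (mid x0 x1 - x1) := by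
    rw [← neg_sub x1, sub_mid]; have : 0 < tau^2 * tau^2 * (x1-x0)^2 := by positivity
    linarith
  have Y1 : 0 < (mid y0 y1 - y0) * (mid y0 y1 - y0) := by
    rw [mid_sub_left]; have : 0 < tau * tau * (y1-y0)^2 := by positivity
    linarith
  have Y2 : 0 < (mid y0 y1 - y1) * (mid y0 y1 - y1) := by
    rw [← neg_sub y1, sub_mid]; have : 0 < tau^2 * tau^2 * (y1-y0)^2 := by positivity
    linarith
  have hx3 : 0 < (x1 - x0) * (x1 - x0) := by rw [← sq]; exact hx2
  have hy3 : 0 < (y1 - y0) * (y1 - y0) := by rw [← sq]; exact hy2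
  cases K <;>
  simp only [children, Rel, ex, ox, ey, oy, List.isChain_cons_cons, List.isChain_singleton, and_true, true_and] <;>
  (repeat' refine And.intro ?_ ?_) <;> first | (left; linarith) | (right; linarith)

lemma children_ne (t : Tile) : children t ≠ [] := by
  rcases t with ⟨K, x0, x1, y0, y1, s, e⟩
  cases K <;> simp [children]

lemma Rel.children {t t' : Tile} (h : Rel t t') :
    ∀ c ∈ (children t).getLast?, ∀ c' ∈ (children t').head?, Rel c c' := by
  have key : ∀ c ∈ (FibCurve.children t).getLast?, c.e = t.e ∧ ex c = ex t ∧ ey c = ey t ∧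
      ∃ a > 0, ∃ b > 0, ox c - ex c = a * (ox t - ex t) ∧ oy c - ey c = b * (oy t - ey t) := by
    have h1 := tau_pos
    have h2 := pow_pos tau_pos 2
    rcases t with ⟨K, x0, x1, y0, y1, s, e⟩
    have a1 := sub_mid x0 x1
    have a2 := sub_mid y0 y1
    have a3 := mid_sub_left x0 x1
    have a4 := mid_sub_left y0 y1
    cases K <;> simp only [FibCurve.children, ex, ey, ox, oy, List.getLast?_cons_cons, List.getLast?_singleton,
      Option.mem_def, Option.some.injEq, forall_eq', true_and]
    · exact ⟨tau^2, h2, tau, h1, by linarith, by linarith⟩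
    · exact ⟨tau, h1, tau^2, h2, by linarith, by linarith⟩
    · exact ⟨1, one_pos, 1, one_pos, by ring, by ring⟩
    · exact ⟨1, one_pos, 1, one_pos, by ring, by ring⟩
    · exact ⟨tau^2, h2, 1, one_pos, by linarith, by linarith⟩
    · exact ⟨1, one_pos, tau^2, h2, by linarith, by linarith⟩
  have key' : ∀ c ∈ (FibCurve.children t').head?, c.s = t'.s ∧ c.x0 = t'.x0 ∧ c.y0 = t'.y0 ∧
      ∃ a > 0, ∃ b > 0, c.x1 - c.x0 = a * (t'.x1 - t'.x0) ∧ c.y1 - c.y0 = b * (t'.y1 - t'.y0) := by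
    have h1 := tau_pos
    rcases t' with ⟨K, x0, x1, y0, y1, s, e⟩
    have a3 := mid_sub_left x0 x1
    have a4 := mid_sub_left y0 y1
    cases K <;> simp only [FibCurve.children, List.head?_cons,
      Option.mem_def, Option.some.injEq, forall_eq', true_and]
    · exact ⟨tau, h1, tau, h1, by linarith, by linarith⟩
    · exact ⟨tau, h1, tau, h1, by linarith, by linarith⟩
    · exact ⟨1, one_pos, 1, one_pos, by ring, by ring⟩
    · exact ⟨1, one_pos, 1, one_pos, by ring, by ring⟩
    · exact ⟨tau, h1, 1, one_pos, by linarith, by linarith⟩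
    · exact ⟨1, one_pos, tau, h1, by linarith, by linarith⟩
  intro c hc c' hc'
  obtain ⟨p1, p2, p3, a, ha, b, hb, p4, p5⟩ := key c hc
  obtain ⟨q1, q2, q3, a', ha', b', hb', q4, q5⟩ := key' c' hc'
  obtain ⟨r1, r2, r3, r4⟩ := h
  refine ⟨by rw [p1, q1, r1], by rw [p2, q2, r2], by rw [p3, q3, r3], ?_⟩
  rw [p4, p5, q4, q5]
  rcases r4 with r4 | r4
  · left
    have := mul_pos (mul_pos ha ha') r4
    linarith
  · right
    have := mul_pos (mul_pos hb hb') r4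
    linarith

noncomputable def root : Tile := ⟨QH, 0, 1, 0, 1, 0, 1⟩

noncomputable def L : ℕ → List Tile
  | 0 => [root]
  | k + 1 => (L k).flatMap children

lemma L_wf (k : ℕ) : ∀ t ∈ L k, WF k t := by
  induction k with
  | zero => simp [L, root, WF, wid, hei]
  | succ k ih =>
    intro t ht
    obtain ⟨p, hp, hc⟩ := List.mem_flatMap.1 ht
    exact (ih p hp).children t hc

lemma L_child {k : ℕ} {t c : Tile} (h : t ∈ L k) (hc : c ∈ children t) : c ∈ L (k+1) :=
  List.mem_flatMap.2 ⟨t, h, hc⟩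

lemma L_chain (k : ℕ) : (L k).IsChain Rel := by
  induction k with
  | zero => simp [L]
  | succ k ih =>
    rw [L, List.flatMap, List.isChain_flatten]
    · constructor
      · intro l hl
        obtain ⟨t, ht, rfl⟩ := List.mem_map.1 hl
        exact children_chain (L_wf k t ht)
      · rw [List.isChain_map]
        exact ih.imp fun a b hab => hab.children
    · intro h
      obtain ⟨t, _, ht⟩ := List.mem_map.1 h
      exact children_ne t ht

lemma L_dis (k : ℕ) : (L k).Pairwise Dis := by
  induction k with
  | zero => simp [L]
  | succ k ih =>
    rw [L, List.pairwise_flatMap]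
    refine ⟨fun t _ => children_dis t, ih.imp ?_⟩
    intro a b hab c hc d hd
    exact hab.mono (interior_mono (children_cell c hc)) (interior_mono (children_cell d hd))

lemma L_time_cover (k : ℕ) (z : ℝ) : z ∈ Icc (0:ℝ) 1 ↔ ∃ t ∈ L k, z ∈ Icc t.s t.e := by
  induction k with
  | zero => simp [L, root]
  | succ k ih =>
    rw [ih]
    constructor
    · rintro ⟨t, ht, hz⟩
      obtain ⟨c, hc, hz⟩ := children_time_cover hz
      exact ⟨c, L_child ht hc, hz⟩
    · rintro ⟨c, hc, hz⟩
      obtain ⟨t, ht, hc⟩ := List.mem_flatMap.1 hc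
      exact ⟨t, ht, children_time (L_wf k t ht).lt.le c hc hz⟩

lemma L_cell_cover (k : ℕ) (z : ℝ × ℝ) :
    z ∈ Icc (0:ℝ) 1 ×ˢ Icc (0:ℝ) 1 ↔ ∃ t ∈ L k, z ∈ cell t := by
  induction k with
  | zero => simp [L, root, cell]
  | succ k ih =>
    rw [ih]
    constructor
    · rintro ⟨t, ht, hz⟩
      obtain ⟨c, hc, hz⟩ := children_cell_mem.1 hz
      exact ⟨c, L_child ht hc, hz⟩
    · rintro ⟨c, hc, hz⟩
      obtain ⟨t, ht, hc⟩ := List.mem_flatMap.1 hc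
      exact ⟨t, ht, children_cell c hc hz⟩

def W (n : ℕ) (t : Tile) : ℕ := match t.kind with
  | QH => Nat.fib (n+2) ^ 2
  | QV => Nat.fib (n+2) ^ 2
  | qH => Nat.fib (n+1) ^ 2
  | qV => Nat.fib (n+1) ^ 2
  | RH => Nat.fib (n+2) * Nat.fib (n+1)
  | RV => Nat.fib (n+2) * Nat.fib (n+1)

lemma W_children (n : ℕ) (t : Tile) : ((children t).map (W n)).sum = W (n+1) t := by
  have h : Nat.fib (n+1+2) = Nat.fib (n+1) + Nat.fib (n+2) := Nat.fib_add_two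
  rcases t with ⟨K, x0, x1, y0, y1, s, e⟩
  cases K <;> simp only [children, W, List.map_cons, List.map_nil, List.sum_cons, List.sum_nil, h] <;> ring

lemma W_L (k n : ℕ) : ((L k).map (W n)).sum = Nat.fib (n + k + 2) ^ 2 := by
  induction k generalizing n with
  | zero => simp [L, W, root]
  | succ k ih =>
    have := ih (n+1)
    rw [show n + (k+1) + 2 = n + 1 + k + 2 by ring, ← this, L]
    simp only [List.flatMap, List.map_flatten, List.sum_flatten, List.map_map]
    congr 1
    apply List.map_congr_left
    intro t _
    exact W_children n t

lemma L_length (k : ℕ) : (L k).length = Nat.fib (k + 2) ^ 2 := by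
  have := W_L k 0
  rw [zero_add] at this
  rw [← this, show W 0 = fun _ => 1 from ?_]
  · simp
  · funext t
    unfold W
    cases t.kind <;> simp

lemma dist_cell {k : ℕ} {t : Tile} (h : WF k t) {p q : ℝ × ℝ} (hp : p ∈ cell t) (hq : q ∈ cell t) :
    dist p q ≤ tau ^ k := by
  rw [Prod.dist_eq, Real.dist_eq, Real.dist_eq]
  apply max_le
  · refine le_trans ?_ (wid_le k t.kind)
    rw [← h.1, abs_sub_comm t.x1]
    rw [abs_sub_comm]
    have := abs_sub_le_of_uIcc_subset_uIcc (uIcc_subset_uIcc hp.1 hq.1)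
    rwa [abs_sub_comm t.x0]
  · refine le_trans ?_ (hei_le k t.kind)
    rw [← h.2.1, abs_sub_comm t.y1]
    rw [abs_sub_comm]
    have := abs_sub_le_of_uIcc_subset_uIcc (uIcc_subset_uIcc hp.2 hq.2)
    rwa [abs_sub_comm t.y0]

lemma Rel.point {t t' : Tile} (h : Rel t t') : (cell t ∩ cell t').Nonempty := by
  refine ⟨(ex t, ey t), ?_, ?_⟩
  · rw [cell_eq]; exact ⟨left_mem_uIcc, left_mem_uIcc⟩
  · rw [h.2.1, h.2.2.1]; exact ⟨left_mem_uIcc, left_mem_uIcc⟩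

lemma L_rel (k i : ℕ) (h : i + 1 < (L k).length) : Rel (L k)[i] (L k)[i+1] :=
  List.isChain_iff_getElem.1 (L_chain k) i h

lemma L_mono (k i j : ℕ) (hij : i < j) (hj : j < (L k).length) :
    ((L k)[i]).e ≤ ((L k)[j]).s := by
  induction j, hij using Nat.le_induction with
  | base => exact (L_rel k i hj).1.le
  | succ j hij ih =>
    have h1 := ih (by omega)
    have h2 := (L_wf k _ (List.getElem_mem (show j < (L k).length by omega))).lt
    have h3 := (L_rel k j hj).1
    linarith

lemma L_meet {k : ℕ} {t t' : Tile} (ht : t ∈ L k) (ht' : t' ∈ L k) {z : ℝ}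
    (hz : z ∈ Icc t.s t.e) (hz' : z ∈ Icc t'.s t'.e) : (cell t ∩ cell t').Nonempty := by
  obtain ⟨i, hi, rfl⟩ := List.getElem_of_mem ht
  obtain ⟨j, hj, rfl⟩ := List.getElem_of_mem ht'
  have main : ∀ i j (hi : i < (L k).length) (hj : j < (L k).length), i < j →
      z ∈ Icc ((L k)[i]).s ((L k)[i]).e → z ∈ Icc ((L k)[j]).s ((L k)[j]).e →
      (cell (L k)[i] ∩ cell (L k)[j]).Nonempty := by
    intro i j hi hj hij hz hz'
    rcases Nat.lt_or_ge (i+1) j with h | h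
    · exfalso
      have h1 := L_mono k (i+1) j h hj
      have h2 := (L_wf k _ (List.getElem_mem (show i + 1 < (L k).length by omega))).lt
      have h3 := (L_rel k i (by omega)).1
      have := hz.2
      have := hz'.1
      linarith
    · obtain rfl : j = i + 1 := by omega
      exact (L_rel k i hj).point
  rcases lt_trichotomy i j with h | h | h
  · exact main i j hi hj h hz hz'
  · subst h
    exact ⟨((L k)[i].x0, (L k)[i].y0), ⟨left_mem_uIcc, left_mem_uIcc⟩, ⟨left_mem_uIcc, left_mem_uIcc⟩⟩
  · rw [inter_comm]
    exact main j i hj hi h hz' hz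

/-- Descent. -/
lemma descent (P : Tile → Prop) (hP : ∀ t, P t → ∃ c ∈ children t, P c) {k : ℕ} {t : Tile}
    (ht : t ∈ L k) (h : P t) :
    ∃ T : ℕ → Tile, T 0 = t ∧ (∀ n, T n ∈ L (k + n)) ∧ (∀ n, P (T n)) ∧
      ∀ n, T (n+1) ∈ children (T n) := by
  choose! f hf hf' using hP
  refine ⟨fun n => f^[n] t, rfl, ?_, ?_, ?_⟩
  · have : ∀ n, f^[n] t ∈ L (k+n) ∧ P (f^[n] t) := by
      intro n
      induction n with
      | zero => exact ⟨ht, h⟩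
      | succ n ih =>
        rw [Function.iterate_succ_apply']
        exact ⟨L_child ih.1 (hf _ ih.2), hf' _ ih.2⟩
    exact fun n => (this n).1
  · intro n
    induction n with
    | zero => exact h
    | succ n ih =>
      simp only [Function.iterate_succ_apply'] at *
      exact hf' _ ih
  · intro n
    have : ∀ n, P (f^[n] t) := by
      intro n
      induction n with
      | zero => exact h
      | succ n ih =>
        rw [Function.iterate_succ_apply']
        exact hf' _ ih
    simp only [Function.iterate_succ_apply']
    exact hf _ (this n)

lemma cell_compact (t : Tile) : IsCompact (cell t) := isCompact_uIcc.prod isCompact_uIcc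

lemma pow_small {ε : ℝ} (h : 0 < ε) : ∃ n : ℕ, tau ^ n < ε :=
  exists_pow_lt_of_lt_one h tau_lt_one

lemma exists_F (z : ℝ) : ∃ p : ℝ × ℝ, ∀ k, ∀ t ∈ L k, z ∈ Icc t.s t.e → p ∈ cell t := by
  by_cases hz : z ∈ Icc (0:ℝ) 1
  swap
  · exact ⟨0, fun k t ht h => absurd ((L_time_cover k z).2 ⟨t, ht, h⟩) hz⟩
  obtain ⟨T, -, hT, hzT, hch⟩ := descent (fun t => z ∈ Icc t.s t.e) (fun t h => children_time_cover h)
    (k := 0) (t := root) (by simp [L]) (by simpa [root] using hz)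
  obtain ⟨p, hp⟩ := IsCompact.nonempty_iInter_of_sequence_nonempty_isCompact_isClosed
    (fun n => cell (T n)) (fun n => children_cell _ (hch n))
    (fun n => ⟨((T n).x0, (T n).y0), left_mem_uIcc, left_mem_uIcc⟩) (cell_compact _)
    (fun n => (cell_compact _).isClosed)
  rw [mem_iInter] at hp
  refine ⟨p, fun k t ht hzt => ?_⟩
  obtain ⟨S, hS0, hS, hzS, hchS⟩ := descent (fun t => z ∈ Icc t.s t.e)
    (fun t h => children_time_cover h) ht hzt
  have hsub : ∀ n, cell (S n) ⊆ cell t := by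
    intro n
    induction n with
    | zero => rw [hS0]
    | succ n ih => exact (children_cell _ (hchS n)).trans ih
  rw [← (cell_compact t).isClosed.closure_eq, Metric.mem_closure_iff]
  intro ε hε
  obtain ⟨n, hn⟩ := pow_small hε
  have hT' := hT (k+n)
  rw [zero_add] at hT'
  obtain ⟨q, hq1, hq2⟩ := L_meet hT' (hS n) (hzT _) (hzS _)
  refine ⟨q, hsub n hq2, (dist_cell (L_wf _ _ hT') (hp _) hq1).trans_lt (lt_of_le_of_lt ?_ hn)⟩
  exact pow_le_pow_of_le_one tau_pos.le tau_lt_one.le (Nat.le_add_left n k)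

noncomputable def F (z : ℝ) : ℝ × ℝ := (exists_F z).choose

lemma F_mem {k : ℕ} {t : Tile} (ht : t ∈ L k) {z : ℝ} (hz : z ∈ Icc t.s t.e) : F z ∈ cell t :=
  (exists_F z).choose_spec k t ht hz

lemma F_image {k : ℕ} {t : Tile} (ht : t ∈ L k) : F '' Icc t.s t.e = cell t := by
  apply Subset.antisymm
  · rintro _ ⟨z, hz, rfl⟩
    exact F_mem ht hz
  · intro p hp
    obtain ⟨S, hS0, hS, hpS, hchS⟩ := descent (fun t => p ∈ cell t)
      (fun t h => children_cell_mem.1 h) ht hp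
    obtain ⟨z, hz⟩ := IsCompact.nonempty_iInter_of_sequence_nonempty_isCompact_isClosed
      (fun n => Icc (S n).s (S n).e)
      (fun n => children_time (L_wf _ _ (hS n)).lt.le _ (hchS n))
      (fun n => nonempty_Icc.2 (L_wf _ _ (hS n)).lt.le) isCompact_Icc
      (fun n => isClosed_Icc)
    rw [mem_iInter] at hz
    refine ⟨z, ?_, ?_⟩
    · have := hz 0
      rwa [hS0] at this
    · apply eq_of_forall_dist_le
      intro ε hε
      obtain ⟨n, hn⟩ := pow_small hε
      refine (dist_cell (L_wf _ _ (hS n)) (F_mem (hS n) (hz n)) (hpS n)).trans (le_trans ?_ hn.le)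
      exact pow_le_pow_of_le_one tau_pos.le tau_lt_one.le (Nat.le_add_left n k)

lemma F_cont : ContinuousOn F (Icc 0 1) := by
  intro z hz
  rw [Metric.continuousWithinAt_iff']
  intro ε hε
  obtain ⟨k, hk⟩ := pow_small hε
  have hfin : {t | t ∈ L k ∧ z ∉ Icc t.s t.e}.Finite :=
    (List.finite_toSet (L k)).subset fun t h => h.1
  have hcl : IsClosed (⋃ t ∈ {t | t ∈ L k ∧ z ∉ Icc t.s t.e}, Icc t.s t.e) :=
    hfin.isClosed_biUnion fun _ _ => isClosed_Icc
  have hnm : z ∈ (⋃ t ∈ {t | t ∈ L k ∧ z ∉ Icc t.s t.e}, Icc t.s t.e)ᶜ := by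
    simp only [mem_compl_iff, mem_iUnion, not_exists]
    intro t ht
    exact ht.2
  filter_upwards [self_mem_nhdsWithin, mem_nhdsWithin_of_mem_nhds (hcl.isOpen_compl.mem_nhds hnm)]
    with w hw hw'
  obtain ⟨t, ht, hwt⟩ := (L_time_cover k w).1 hw
  have hzt : z ∈ Icc t.s t.e := by
    by_contra h
    exact hw' (mem_iUnion₂.2 ⟨t, ⟨ht, h⟩, hwt⟩)
  exact (dist_cell (L_wf k t ht) (F_mem ht hwt) (F_mem ht hzt)).trans_lt hk

lemma common {c a b : ℝ} (h : 0 < (a - c) * (b - c)) : ∃ q, c ≠ q ∧ q ∈ uIcc c a ∧ q ∈ uIcc c b := by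
  rcases pos_and_pos_or_neg_and_neg_of_mul_pos h with ⟨h1, h2⟩ | ⟨h1, h2⟩
  · refine ⟨min a b, ?_, ?_, ?_⟩
    · exact (lt_min (by linarith) (by linarith)).ne
    · rw [mem_uIcc]; left; exact ⟨le_min (by linarith) (by linarith), min_le_left _ _⟩
    · rw [mem_uIcc]; left; exact ⟨le_min (by linarith) (by linarith), min_le_right _ _⟩
  · refine ⟨max a b, ?_, ?_, ?_⟩
    · exact (max_lt (by linarith) (by linarith)).ne'
    · rw [mem_uIcc]; right; exact ⟨le_max_left _ _, max_le (by linarith) (by linarith)⟩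
    · rw [mem_uIcc]; right; exact ⟨le_max_right _ _, max_le (by linarith) (by linarith)⟩

lemma cell_convex (t : Tile) : Convex ℝ (cell t) := (convex_uIcc _ _).prod (convex_uIcc _ _)

lemma Rel.segment {t t' : Tile} (h : Rel t t') :
    ∃ p q : ℝ × ℝ, p ≠ q ∧ segment ℝ p q ⊆ cell t ∩ cell t' := by
  obtain ⟨-, h1, h2, h3⟩ := h
  suffices ∃ p q : ℝ × ℝ, p ≠ q ∧ p ∈ cell t ∩ cell t' ∧ q ∈ cell t ∩ cell t' by
    obtain ⟨p, q, hne, hp, hq⟩ := this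
    exact ⟨p, q, hne, ((cell_convex t).inter (cell_convex t')).segment_subset hp hq⟩
  rw [cell_eq t, cell, ← h1, ← h2]
  rw [← h1, ← h2] at h3
  rcases h3 with h3 | h3
  · obtain ⟨q, hne, hq1, hq2⟩ := common h3
    refine ⟨(ex t, ey t), (q, ey t), ?_, ?_, ?_⟩
    · intro h; exact hne (congrArg Prod.fst h)
    · exact ⟨⟨left_mem_uIcc, left_mem_uIcc⟩, ⟨left_mem_uIcc, left_mem_uIcc⟩⟩
    · exact ⟨⟨hq1, left_mem_uIcc⟩, ⟨hq2, left_mem_uIcc⟩⟩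
  · obtain ⟨q, hne, hq1, hq2⟩ := common h3
    refine ⟨(ex t, ey t), (ex t, q), ?_, ?_, ?_⟩
    · intro h; exact hne (congrArg Prod.snd h)
    · exact ⟨⟨left_mem_uIcc, left_mem_uIcc⟩, ⟨left_mem_uIcc, left_mem_uIcc⟩⟩
    · exact ⟨⟨left_mem_uIcc, hq1⟩, ⟨left_mem_uIcc, hq2⟩⟩

lemma cell_volume {k : ℕ} {t : Tile} (h : WF k t) : volume (Icc t.s t.e) = volume (cell t) := by
  rw [cell, Measure.volume_eq_prod, Measure.prod_prod, Real.volume_interval, Real.volume_interval,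
    Real.volume_Icc, h.1, h.2.1, h.2.2, ENNReal.ofReal_mul (wid_pos _ _).le]

noncomputable def T (k i : ℕ) : Tile := (L k).getD i root

lemma T_eq {k i : ℕ} (h : i < Nat.fib (k+2) ^ 2) :
    ∃ h' : i < (L k).length, T k i = (L k)[i] := by
  rw [← L_length] at h
  exact ⟨h, by simp [T, h]⟩

lemma T_mem {k i : ℕ} (h : i < Nat.fib (k+2) ^ 2) : T k i ∈ L k := by
  obtain ⟨h', e⟩ := T_eq h
  rw [e]; exact List.getElem_mem h'

lemma exists_T {k : ℕ} {t : Tile} (h : t ∈ L k) : ∃ i < Nat.fib (k+2)^2, T k i = t := by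
  obtain ⟨i, hi, rfl⟩ := List.getElem_of_mem h
  refine ⟨i, by rwa [← L_length], by simp [T, hi]⟩

lemma T_rel {k i : ℕ} (h : i + 1 < Nat.fib (k+2) ^ 2) : Rel (T k i) (T k (i+1)) := by
  obtain ⟨h1, e1⟩ := T_eq (k := k) (i := i) (by omega)
  obtain ⟨h2, e2⟩ := T_eq h
  rw [e1, e2]; exact L_rel k i h2

lemma T_mono {k i j : ℕ} (hij : i < j) (h : j < Nat.fib (k+2) ^ 2) : (T k i).e ≤ (T k j).s := by
  obtain ⟨h1, e1⟩ := T_eq (k := k) (i := i) (by omega)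
  obtain ⟨h2, e2⟩ := T_eq h
  rw [e1, e2]; exact L_mono k i j hij h2

lemma T_dis {k i j : ℕ} (hij : i < j) (h : j < Nat.fib (k+2) ^ 2) : Dis (T k i) (T k j) := by
  obtain ⟨h1, e1⟩ := T_eq (k := k) (i := i) (by omega)
  obtain ⟨h2, e2⟩ := T_eq h
  rw [e1, e2]; exact List.pairwise_iff_getElem.1 (L_dis k) i j h1 h2 hij

lemma tau_pow (k : ℕ) : tau ^ k = (goldenRatio' ^ k)⁻¹ := by rw [tau, inv_pow]

end FibCurve

open FibCurve in
/-- There is a continuous surjection `F : [0,1] → [0,1]×[0,1]`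
(the Fibonacci space-filling curve) together with, for every `k`, families
`I k 0, …, I k (fib(k+2)²-1)` of closed subintervals of `[0,1]` and
`J k 0, …, J k (fib(k+2)²-1)` of closed axis-parallel rectangles in the unit
square such that: the intervals have positive length, pairwise disjoint
interiors, union `[0,1]` and are consecutively ordered; the rectangles have
side lengths in `{φ^{-(k+1)}, φ^{-k}}`, pairwise disjoint interiors and union
the unit square; the length of `I k i` equals the area of `J k i`; `F` maps
`I k i` onto `J k i`; and consecutive rectangles share a line segment of
positive length (connectedness of the space-filling curve). -/
theorem exists_fibonacci_space_filling_curve :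
    ∃ (F : ℝ → ℝ × ℝ) (I : ℕ → ℕ → Set ℝ) (J : ℕ → ℕ → Set (ℝ × ℝ)),
      ContinuousOn F (Icc 0 1) ∧
      F '' Icc 0 1 = Icc (0 : ℝ) 1 ×ˢ Icc (0 : ℝ) 1 ∧
      ∀ k : ℕ,
        -- (i) the intervals
        (∀ i < Nat.fib (k + 2) ^ 2, ∃ a b : ℝ, a < b ∧ I k i = Icc a b) ∧
        (∀ i < Nat.fib (k + 2) ^ 2, ∀ j < Nat.fib (k + 2) ^ 2, i ≠ j →
          interior (I k i) ∩ interior (I k j) = ∅) ∧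
        (⋃ i ∈ Finset.range (Nat.fib (k + 2) ^ 2), I k i) = Icc (0 : ℝ) 1 ∧
        (∀ i : ℕ, i + 1 < Nat.fib (k + 2) ^ 2 → sSup (I k i) = sInf (I k (i + 1))) ∧
        -- (ii) the rectangles
        (∀ i < Nat.fib (k + 2) ^ 2, ∃ a b c d : ℝ,
          J k i = Icc a b ×ˢ Icc c d ∧
          (b - a = (goldenRatio' ^ (k + 1))⁻¹ ∨ b - a = (goldenRatio' ^ k)⁻¹) ∧
          (d - c = (goldenRatio' ^ (k + 1))⁻¹ ∨ d - c = (goldenRatio' ^ k)⁻¹)) ∧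
        (∀ i < Nat.fib (k + 2) ^ 2, ∀ j < Nat.fib (k + 2) ^ 2, i ≠ j →
          interior (J k i) ∩ interior (J k j) = ∅) ∧
        (⋃ i ∈ Finset.range (Nat.fib (k + 2) ^ 2), J k i) = Icc (0 : ℝ) 1 ×ˢ Icc (0 : ℝ) 1 ∧
        -- (iii) length of `I k i` equals area of `J k i`
        (∀ i < Nat.fib (k + 2) ^ 2, volume (I k i) = volume (J k i)) ∧
        -- (iv) `F` maps `I k i` onto `J k i`
        (∀ i < Nat.fib (k + 2) ^ 2, F '' I k i = J k i) ∧
        -- (v) consecutive rectangles share a segment of positive length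
        (∀ i : ℕ, i + 1 < Nat.fib (k + 2) ^ 2 → ∃ p q : ℝ × ℝ, p ≠ q ∧
          segment ℝ p q ⊆ J k i ∩ J k (i + 1)) := by
  refine ⟨F, fun k i => Icc (T k i).s (T k i).e, fun k i => cell (T k i), F_cont, ?_, ?_⟩
  · have := F_image (k := 0) (t := root) (by simp [L])
    simpa [root, cell] using this
  intro k
  refine ⟨?_, ?_, ?_, ?_, ?_, ?_, ?_, ?_, ?_, ?_⟩
  · intro i hi
    exact ⟨_, _, (L_wf k _ (T_mem hi)).lt, rfl⟩
  · intro i hi j hj hij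
    have main : ∀ i j, i < j → j < Nat.fib (k+2)^2 →
        interior (Icc (T k i).s (T k i).e) ∩ interior (Icc (T k j).s (T k j).e) = ∅ := by
      intro i j hij hj
      have := T_mono hij hj
      ext z
      simp only [interior_Icc, mem_inter_iff, mem_Ioo, mem_empty_iff_false, iff_false]
      rintro ⟨⟨_, h1⟩, ⟨h2, _⟩⟩
      linarith
    rcases lt_or_gt_of_ne hij with h | h
    · exact main i j h hj
    · rw [inter_comm]; exact main j i h hi
  · ext z
    rw [L_time_cover k z]
    simp only [mem_iUnion, Finset.mem_range, exists_prop]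
    constructor
    · rintro ⟨i, hi, h⟩; exact ⟨_, T_mem hi, h⟩
    · rintro ⟨t, ht, h⟩
      obtain ⟨i, hi, rfl⟩ := exists_T ht
      exact ⟨i, hi, h⟩
  · intro i hi
    have h1 := (L_wf k _ (T_mem (k := k) (i := i) (by omega))).lt.le
    have h2 := (L_wf k _ (T_mem hi)).lt.le
    rw [csSup_Icc h1, csInf_Icc h2]
    exact (T_rel hi).1
  · intro i hi
    obtain ⟨h1, h2, -⟩ := L_wf k _ (T_mem hi)
    refine ⟨_, _, _, _, rfl, ?_, ?_⟩
    · change max _ _ - min _ _ = _ ∨ max _ _ - min _ _ = _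
      rw [max_sub_min_eq_abs, h1, ← tau_pow, ← tau_pow]
      exact wid_or k _
    · change max _ _ - min _ _ = _ ∨ max _ _ - min _ _ = _
      rw [max_sub_min_eq_abs, h2, ← tau_pow, ← tau_pow]
      exact hei_or k _
  · intro i hi j hj hij
    rcases lt_or_gt_of_ne hij with h | h
    · exact (T_dis h hj).inter_eq
    · exact (T_dis h hi).symm.inter_eq
  · ext z
    rw [L_cell_cover k z]
    simp only [mem_iUnion, Finset.mem_range, exists_prop]
    constructor
    · rintro ⟨i, hi, h⟩; exact ⟨_, T_mem hi, h⟩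
    · rintro ⟨t, ht, h⟩
      obtain ⟨i, hi, rfl⟩ := exists_T ht
      exact ⟨i, hi, h⟩
  · intro i hi
    exact cell_volume (L_wf k _ (T_mem hi))
  · intro i hi
    exact F_image (T_mem hi)
  · intro i hi
    exact (T_rel hi).segment
end

section
/- Let n : ℕ → ℕ with n(k) ≥ 1 for all k. For each k ∈ ℕ and each 1 ≤ i ≤ n(k), let I^k_i ⊆ [0,1] be a closed interval of positive length and let J^k_i ⊆ [0,1] × [0,1] be a nonempty closed set. Assume: (i) for each k, the intervals I^k_1, …, I^k_{n(k)} have pairwise disjoint interiors and their union is [0,1], and the sets J^k_1, …, J^k_{n(k)} have union [0,1] × [0,1]; (ii) (refinement) for every k and every 1 ≤ j ≤ n(k+1) there exists 1 ≤ i ≤ n(k) with I^{k+1}_j ⊆ I^k_i and J^{k+1}_j ⊆ J^k_i; (iii) (compatibility) for every k and all i, j, if I^k_i ∩ I^k_j ≠ ∅ then J^k_i ∩ J^k_j ≠ ∅; (iv) max_{1 ≤ i ≤ n(k)} diam(J^k_i) → 0 as k → ∞. Then there exists a continuous surjection F : [0,1] → [0,1] × [0,1] such that for every k ∈ ℕ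 and every x ∈ [0,1] there exists 1 ≤ i ≤ n(k) with x ∈ I^k_i and F(x) ∈ J^k_i. -/
open Set

/-- The general nested-partition interpolation principle:
given, for each `k`, a partition of `[0,1]` into `n k ≥ 1` closed intervals of
positive length with pairwise disjoint interiors, and nonempty closed sets
`J k i ⊆ [0,1]×[0,1]` covering the unit square, such that the families refine
each other, the chosen sets are compatible (intersecting intervals correspond
to intersecting sets), and the maximal diameter of the sets `J k i` tends to
`0`, there exists a continuous surjection `F : [0,1] → [0,1]×[0,1]` such that
for every `k` and `x ∈ [0,1]` there is `i < n k` with `x ∈ I k i` and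
`F x ∈ J k i`. -/
theorem exists_space_filling_curve_of_nested_partitions
    (n : ℕ → ℕ) (hn : ∀ k, 1 ≤ n k)
    (I : ℕ → ℕ → Set ℝ) (J : ℕ → ℕ → Set (ℝ × ℝ))
    (hI : ∀ k, ∀ i < n k, ∃ a b : ℝ, a < b ∧ I k i = Icc a b)
    (hIsub : ∀ k, ∀ i < n k, I k i ⊆ Icc (0 : ℝ) 1)
    (hJne : ∀ k, ∀ i < n k, (J k i).Nonempty)
    (hJcl : ∀ k, ∀ i < n k, IsClosed (J k i))
    (hJsub : ∀ k, ∀ i < n k, J k i ⊆ Icc (0 : ℝ) 1 ×ˢ Icc (0 : ℝ) 1)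
    -- (i) partition / covering properties
    (hIdisj : ∀ k, ∀ i < n k, ∀ j < n k, i ≠ j →
      interior (I k i) ∩ interior (I k j) = ∅)
    (hIunion : ∀ k, (⋃ i ∈ Finset.range (n k), I k i) = Icc (0 : ℝ) 1)
    (hJunion : ∀ k, (⋃ i ∈ Finset.range (n k), J k i) = Icc (0 : ℝ) 1 ×ˢ Icc (0 : ℝ) 1)
    -- (ii) refinement
    (href : ∀ k, ∀ j < n (k + 1), ∃ i < n k, I (k + 1) j ⊆ I k i ∧ J (k + 1) j ⊆ J k i)
    -- (iii) compatibility
    (hcompat : ∀ k, ∀ i < n k, ∀ j < n k,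
      (I k i ∩ I k j).Nonempty → (J k i ∩ J k j).Nonempty)
    -- (iv) maximal diameter tends to zero
    (hdiam : Filter.Tendsto
      (fun k => (Finset.range (n k)).sup fun i => EMetric.diam (J k i))
      Filter.atTop (nhds 0)) :
    ∃ F : ℝ → ℝ × ℝ,
      ContinuousOn F (Icc 0 1) ∧
      F '' Icc 0 1 = Icc (0 : ℝ) 1 ×ˢ Icc (0 : ℝ) 1 ∧
      ∀ k : ℕ, ∀ x ∈ Icc (0 : ℝ) 1, ∃ i < n k, x ∈ I k i ∧ F x ∈ J k i := by
  classical
  let G : ℕ → Set (ℝ × (ℝ × ℝ)) := fun k => ⋃ i ∈ Finset.range (n k), (I k i) ×ˢ (J k i)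
  have hmem : ∀ k x p, (x, p) ∈ G k ↔ ∃ i < n k, x ∈ I k i ∧ p ∈ J k i := by
    intro k x p
    simp only [G, mem_iUnion, Finset.mem_range, mem_prod, exists_prop]
  have hJc : ∀ k, ∀ i < n k, IsCompact (J k i) := fun k i hi =>
    (isCompact_Icc.prod isCompact_Icc).of_isClosed_subset (hJcl k i hi) (hJsub k i hi)
  have hIc : ∀ k, ∀ i < n k, IsCompact (I k i) := by
    intro k i hi
    obtain ⟨a, b, -, h⟩ := hI k i hi
    rw [h]
    exact isCompact_Icc
  have hGc : ∀ k, IsCompact (G k) := by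
    intro k
    apply (Finset.range (n k)).isCompact_biUnion
    intro i hi
    rw [Finset.mem_range] at hi
    exact (hIc k i hi).prod (hJc k i hi)
  have hGs : ∀ k, G (k + 1) ⊆ G k := by
    rintro k ⟨x, p⟩ h
    rw [hmem] at h ⊢
    obtain ⟨j, hj, hx, hp⟩ := h
    obtain ⟨i, hi, h1, h2⟩ := href k j hj
    exact ⟨i, hi, h1 hx, h2 hp⟩
  have hex : ∀ C : Set (ℝ × (ℝ × ℝ)), IsClosed C → (∀ k, (G k ∩ C).Nonempty) →
      ∃ z, (∀ k, z ∈ G k) ∧ z ∈ C := by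
    intro C hC hne
    obtain ⟨z, hz⟩ := IsCompact.nonempty_iInter_of_sequence_nonempty_isCompact_isClosed
      (fun k => G k ∩ C) (fun k => inter_subset_inter_left _ (hGs k)) hne
      ((hGc 0).inter_right hC) (fun k => (hGc k).isClosed.inter hC)
    rw [mem_iInter] at hz
    exact ⟨z, fun k => (hz k).1, (hz 0).2⟩
  have hx : ∀ x ∈ Icc (0 : ℝ) 1, ∃ p, ∀ k, (x, p) ∈ G k := by
    intro x hx
    obtain ⟨⟨y, p⟩, h1, h2⟩ := hex (Prod.fst ⁻¹' {x})
      (isClosed_singleton.preimage continuous_fst) (by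
        intro k
        rw [← hIunion k] at hx
        simp only [mem_iUnion, Finset.mem_range] at hx
        obtain ⟨i, hi, hx⟩ := hx
        obtain ⟨p, hp⟩ := hJne k i hi
        exact ⟨(x, p), (hmem _ _ _).2 ⟨i, hi, hx, hp⟩, rfl⟩)
    have h3 : y = x := h2
    subst h3
    exact ⟨p, h1⟩
  have hp : ∀ p ∈ Icc (0 : ℝ) 1 ×ˢ Icc (0 : ℝ) 1, ∃ x, ∀ k, (x, p) ∈ G k := by
    intro p hp
    obtain ⟨⟨y, q⟩, h1, h2⟩ := hex (Prod.snd ⁻¹' {p})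
      (isClosed_singleton.preimage continuous_snd) (by
        intro k
        rw [← hJunion k] at hp
        simp only [mem_iUnion, Finset.mem_range] at hp
        obtain ⟨i, hi, hp⟩ := hp
        obtain ⟨a, b, hab, h⟩ := hI k i hi
        exact ⟨(a, p), (hmem _ _ _).2 ⟨i, hi, h ▸ left_mem_Icc.2 hab.le, hp⟩, rfl⟩)
    have h3 : q = p := h2
    subst h3
    exact ⟨y, h1⟩
  have huniq : ∀ x p q, (∀ k, (x, p) ∈ G k) → (∀ k, (x, q) ∈ G k) → p = q := by
    intro x p q h1 h2
    have hle : ∀ k, edist p q ≤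
        ((Finset.range (n k)).sup fun i => EMetric.diam (J k i)) +
        ((Finset.range (n k)).sup fun i => EMetric.diam (J k i)) := by
      intro k
      obtain ⟨i, hi, hxi, hpi⟩ := (hmem _ _ _).1 (h1 k)
      obtain ⟨j, hj, hxj, hqj⟩ := (hmem _ _ _).1 (h2 k)
      obtain ⟨r, hri, hrj⟩ := hcompat k i hi j hj ⟨x, hxi, hxj⟩
      refine (edist_triangle p r q).trans (add_le_add ?_ ?_)
      · exact (Metric.edist_le_ediam_of_mem hpi hri).trans
          (Finset.le_sup (f := fun i => EMetric.diam (J k i)) (Finset.mem_range.2 hi))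
      · exact (Metric.edist_le_ediam_of_mem hrj hqj).trans
          (Finset.le_sup (f := fun i => EMetric.diam (J k i)) (Finset.mem_range.2 hj))
    have h0 := ge_of_tendsto' (hdiam.add hdiam) hle
    rw [add_zero] at h0
    exact edist_le_zero.1 h0
  have hG01 : ∀ x p, (x, p) ∈ G 0 → x ∈ Icc (0 : ℝ) 1 ∧ p ∈ Icc (0 : ℝ) 1 ×ˢ Icc (0 : ℝ) 1 := by
    intro x p h
    obtain ⟨i, hi, h1, h2⟩ := (hmem _ _ _).1 h
    exact ⟨hIsub 0 i hi h1, hJsub 0 i hi h2⟩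
  choose! F hF using hx
  refine ⟨F, ?_, ?_, fun k x hx => (hmem _ _ _).1 (hF x hx k)⟩
  · rw [continuousOn_iff_isClosed]
    intro C hC
    refine ⟨Prod.fst '' ((⋂ k, G k) ∩ Prod.snd ⁻¹' C), ?_, ?_⟩
    · apply IsCompact.isClosed
      apply IsCompact.image _ continuous_fst
      apply IsCompact.inter_right _ (hC.preimage continuous_snd)
      exact (hGc 0).of_isClosed_subset (isClosed_iInter fun k => (hGc k).isClosed)
        (iInter_subset _ 0)
    · ext x
      constructor
      · rintro ⟨h1, h2⟩
        exact ⟨⟨(x, F x), ⟨mem_iInter.2 (hF x h2), h1⟩, rfl⟩, h2⟩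
      · rintro ⟨⟨⟨y, p⟩, ⟨h1, h3⟩, h4⟩, h2⟩
        have h5 : y = x := h4
        subst h5
        have h6 := huniq y p (F y) (mem_iInter.1 h1) (hF y h2)
        subst h6
        exact ⟨h3, h2⟩
  · ext p
    constructor
    · rintro ⟨x, hx, rfl⟩
      exact (hG01 _ _ (hF x hx 0)).2
    · intro h
      obtain ⟨x, hx⟩ := hp p h
      have h1 := (hG01 _ _ (hx 0)).1
      exact ⟨x, h1, huniq _ _ _ (hF x h1) hx⟩
end

section
/- For every k ∈ ℕ and every row index i ∈ {1, …, 24}: if i ∈ {1,2,3,4,13,14,15,16} then the i-th row sum of M^k equals fib(k+2)²; if i ∈ {5,6,7,8,17,18,19,20} then the i-th row sum of M^k equals fib(k+2)·fib(k+1); and if i ∈ {9,10,11,12,21,22,23,24} then the i-th row sum of M^k equals fib(k+1)². (Here M^0 is the identity matrix. In particular, the k-th supertile of any A-type decorated tile of the substitution ω consists of fib(k+2)² tiles.) -/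
/-- For each row index `i ∈ {1, …, 24}`, the set of (1-based) column indices of
the nonzero entries of the substitution matrix of the decorated
Fibonacci-product substitution `ω`. -/
def fibOmegaRowSet : ℕ → Finset ℕ
  | 1 => {5, 10, 16, 19}
  | 2 => {3, 5, 7, 21}
  | 3 => {2, 6, 20, 22}
  | 4 => {9, 13, 18, 20}
  | 5 => {1, 8}
  | 6 => {3, 7}
  | 7 => {2, 6}
  | 8 => {5, 16}
  | 9 => {1}
  | 10 => {2}
  | 11 => {3}
  | 12 => {4}
  | 13 => {4, 7, 17, 22}
  | 14 => {9, 15, 17, 19}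
  | 15 => {8, 10, 14, 18}
  | 16 => {1, 6, 8, 21}
  | 17 => {13, 20}
  | 18 => {15, 19}
  | 19 => {14, 18}
  | 20 => {4, 17}
  | 21 => {13}
  | 22 => {14}
  | 23 => {15}
  | 24 => {16}
  | _ => ∅

/-- The `24 × 24` zero-one substitution matrix `M` of the decorated
Fibonacci-product substitution `ω` (rows and columns indexed `0, …, 23`,
corresponding to the 1-based indices `1, …, 24` of the tiles
`A⁺₁, …, D⁻₄`). -/
def fibOmegaMatrix : Matrix (Fin 24) (Fin 24) ℕ :=
  Matrix.of fun i j => if (j : ℕ) + 1 ∈ fibOmegaRowSet ((i : ℕ) + 1) then 1 else 0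

/-- Indicator of class membership. -/
def fibOmegaInd (s : Finset ℕ) (i : Fin 24) : ℕ := if (i : ℕ) + 1 ∈ s then 1 else 0

def fibOmegaA : Finset ℕ := {1, 2, 3, 4, 13, 14, 15, 16}
def fibOmegaB : Finset ℕ := {5, 6, 7, 8, 17, 18, 19, 20}
def fibOmegaD : Finset ℕ := {9, 10, 11, 12, 21, 22, 23, 24}

set_option maxRecDepth 100000 in
theorem fibOmega_counts : ∀ i : Fin 24,
    (∑ j, fibOmegaMatrix i j * fibOmegaInd fibOmegaA j =
      fibOmegaInd fibOmegaA i + fibOmegaInd fibOmegaB i + fibOmegaInd fibOmegaD i) ∧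
    (∑ j, fibOmegaMatrix i j * fibOmegaInd fibOmegaB j =
      2 * fibOmegaInd fibOmegaA i + fibOmegaInd fibOmegaB i) ∧
    (∑ j, fibOmegaMatrix i j * fibOmegaInd fibOmegaD j = fibOmegaInd fibOmegaA i) := by
  decide +kernel

theorem fibOmega_zero : ∀ i : Fin 24,
    fibOmegaInd fibOmegaA i + fibOmegaInd fibOmegaB i + fibOmegaInd fibOmegaD i = 1 := by
  decide +kernel

theorem fibOmega_sum (k : ℕ) : ∀ i : Fin 24, ∑ j, (fibOmegaMatrix ^ k) i j =
    fibOmegaInd fibOmegaA i * Nat.fib (k + 2) ^ 2 +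
    fibOmegaInd fibOmegaB i * (Nat.fib (k + 2) * Nat.fib (k + 1)) +
    fibOmegaInd fibOmegaD i * Nat.fib (k + 1) ^ 2 := by
  induction k with
  | zero =>
    intro i
    have h := fibOmega_zero i
    simp [Matrix.one_apply]
    omega
  | succ k ih =>
    intro i
    obtain ⟨h1, h2, h3⟩ := fibOmega_counts i
    have e : ∑ j, (fibOmegaMatrix ^ (k + 1)) i j =
        ∑ l, fibOmegaMatrix i l * ∑ j, (fibOmegaMatrix ^ k) l j := by
      simp only [pow_succ', Matrix.mul_apply, Finset.mul_sum]
      exact Finset.sum_comm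
    rw [e]
    simp only [ih, mul_add, Finset.sum_add_distrib, ← mul_assoc, ← Finset.sum_mul, h1, h2, h3]
    have f : Nat.fib (k + 1 + 2) = Nat.fib (k + 1) + Nat.fib (k + 2) := Nat.fib_add_two
    rw [f, show k + 1 + 1 = k + 2 from rfl]
    ring

theorem fibOmega_cases : ∀ i : Fin 24,
    ((i : ℕ) + 1 ∈ fibOmegaA → fibOmegaInd fibOmegaA i = 1 ∧ fibOmegaInd fibOmegaB i = 0 ∧
      fibOmegaInd fibOmegaD i = 0) ∧
    ((i : ℕ) + 1 ∈ fibOmegaB → fibOmegaInd fibOmegaA i = 0 ∧ fibOmegaInd fibOmegaB i = 1 ∧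
      fibOmegaInd fibOmegaD i = 0) ∧
    ((i : ℕ) + 1 ∈ fibOmegaD → fibOmegaInd fibOmegaA i = 0 ∧ fibOmegaInd fibOmegaB i = 0 ∧
      fibOmegaInd fibOmegaD i = 1) := by
  decide +kernel

/-- For every `k` and every row `i` of `M ^ k` (with `M ^ 0`
the identity matrix): rows corresponding to `A`-type tiles have row sum
`fib(k+2)²`, rows corresponding to `B`- and `C`-type tiles have row sum
`fib(k+2) · fib(k+1)`, and rows corresponding to `D`-type tiles have row sum
`fib(k+1)²`. -/
theorem fibOmegaMatrix_pow_row_sums (k : ℕ) (i : Fin 24) :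
    (((i : ℕ) + 1) ∈ ({1, 2, 3, 4, 13, 14, 15, 16} : Finset ℕ) →
      ∑ j, (fibOmegaMatrix ^ k) i j = Nat.fib (k + 2) ^ 2) ∧
    (((i : ℕ) + 1) ∈ ({5, 6, 7, 8, 17, 18, 19, 20} : Finset ℕ) →
      ∑ j, (fibOmegaMatrix ^ k) i j = Nat.fib (k + 2) * Nat.fib (k + 1)) ∧
    (((i : ℕ) + 1) ∈ ({9, 10, 11, 12, 21, 22, 23, 24} : Finset ℕ) →
      ∑ j, (fibOmegaMatrix ^ k) i j = Nat.fib (k + 1) ^ 2) := by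
  obtain ⟨hA, hB, hD⟩ := fibOmega_cases i
  rw [fibOmega_sum]
  refine ⟨fun h => ?_, fun h => ?_, fun h => ?_⟩
  · obtain ⟨a, b, c⟩ := hA h
    simp [a, b, c]
  · obtain ⟨a, b, c⟩ := hB h
    simp [a, b, c]
  · obtain ⟨a, b, c⟩ := hD h
    simp [a, b, c]
end

section
/- The real number φ² = (3+√5)/2 (the square of the golden ratio) is an eigenvalue of the matrix M; that is, there exists a nonzero vector v ∈ ℝ²⁴ with M·v = φ²·v. -/
/-- The `24 × 24` zero-one substitution matrix `M` of the decorated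
Fibonacci-product substitution `ω`, regarded as a real matrix. -/
def fibOmegaMatrixReal : Matrix (Fin 24) (Fin 24) ℝ :=
  Matrix.of fun i j => if (j : ℕ) + 1 ∈ fibOmegaRowSet ((i : ℕ) + 1) then 1 else 0

set_option maxHeartbeats 4000000

/-- The square of the golden ratio, `φ² = (3 + √5)/2`, is an
eigenvalue of the substitution matrix `M`: there is a nonzero vector
`v ∈ ℝ²⁴` with `M · v = φ² · v`. -/
theorem goldenRatio_sq_is_eigenvalue_fibOmegaMatrix :
    ∃ v : Fin 24 → ℝ, v ≠ 0 ∧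
      fibOmegaMatrixReal.mulVec v = ((3 + Real.sqrt 5) / 2) • v := by
  have h5 : Real.sqrt 5 * Real.sqrt 5 = 5 := Real.mul_self_sqrt (by norm_num)
  generalize Real.sqrt 5 = s at h5
  let a : ℝ := (3 + s) / 2
  let b : ℝ := (1 + s) / 2
  refine ⟨![a, a, a, a, b, b, b, b, 1, 1, 1, 1, a, a, a, a, b, b, b, b, 1, 1, 1, 1], ?_, ?_⟩
  · intro h
    have := congrFun h 8
    simp at this
  · funext i
    fin_cases i <;>
      simp [Matrix.mulVec, dotProduct, fibOmegaMatrixReal, fibOmegaRowSet,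
        Fin.sum_univ_succ, a, b] <;> linarith
end

section
/- For every k ∈ ℕ there exists a finite family of fib(k+2) closed subintervals of [0,1] with pairwise disjoint interiors whose union is [0,1], consisting of exactly fib(k+1) intervals of length φ^{-k} and exactly fib(k) intervals of length φ^{-(k+1)}. (In particular, fib(k+1)·φ^{-k} + fib(k)·φ^{-(k+1)} = 1, equivalently φ^{k+1} = fib(k+1)·φ + fib(k).) -/
open Set

theorem gr_sq : goldenRatio' ^ 2 = goldenRatio' + 1 := by
  unfold goldenRatio'
  have h : Real.sqrt 5 ^ 2 = 5 := Real.sq_sqrt (by norm_num)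
  nlinarith

theorem gr_one_lt : 1 < goldenRatio' := by
  unfold goldenRatio'
  have h : 1 < Real.sqrt 5 := by
    rw [Real.lt_sqrt] <;> norm_num
  linarith

theorem gr_pow (k : ℕ) :
    goldenRatio' ^ (k + 1) = (Nat.fib (k + 1) : ℝ) * goldenRatio' + (Nat.fib k : ℝ) := by
  induction k with
  | zero => simp
  | succ k ih =>
    rw [pow_succ, ih, Nat.fib_add_two]
    push_cast
    linear_combination (Nat.fib (k + 1) : ℝ) * gr_sq

theorem gr_sum (k : ℕ) : (Nat.fib (k + 1) : ℝ) * (goldenRatio' ^ k)⁻¹ +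
      (Nat.fib k : ℝ) * (goldenRatio' ^ (k + 1))⁻¹ = 1 := by
  have h0 : goldenRatio' ≠ 0 := (lt_trans one_pos gr_one_lt).ne'
  have h := gr_pow k
  have h1 : (goldenRatio' ^ k)⁻¹ = goldenRatio' * (goldenRatio' ^ (k + 1))⁻¹ := by
    field_simp
    ring
  rw [h1]
  have h2 : goldenRatio' ^ (k + 1) * (goldenRatio' ^ (k + 1))⁻¹ = 1 :=
    mul_inv_cancel₀ (pow_ne_zero _ h0)
  linear_combination h2 - (goldenRatio' ^ (k + 1))⁻¹ * h

noncomputable def fpt (F : ℕ) (x y : ℝ) (n : ℕ) : ℝ :=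
  (min n F : ℕ) * x + (n - F : ℕ) * y

theorem fpt_step (F : ℕ) (x y : ℝ) (n : ℕ) :
    fpt F x y (n + 1) - fpt F x y n = if n < F then x else y := by
  unfold fpt
  split_ifs with h
  · rw [min_eq_left (by omega : n + 1 ≤ F), min_eq_left h.le,
      Nat.sub_eq_zero_of_le (by omega : n + 1 ≤ F), Nat.sub_eq_zero_of_le h.le]
    push_cast; ring
  · rw [min_eq_right (by omega : F ≤ n + 1), min_eq_right (by omega : F ≤ n),
      (by omega : n + 1 - F = (n - F) + 1)]
    push_cast; ring

theorem cover_aux (p : ℕ → ℝ) (t : ℝ) (h0 : p 0 ≤ t) (N : ℕ) (hN : 0 < N) (h : t ≤ p N) :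
    ∃ n < N, p n ≤ t ∧ t ≤ p (n + 1) := by
  induction N with
  | zero => omega
  | succ N ih =>
    by_cases hc : p N ≤ t
    · exact ⟨N, by omega, hc, h⟩
    · have : 0 < N := by
        rcases Nat.eq_zero_or_pos N with h | h
        · subst h; exact absurd h0 hc
        · exact h
      obtain ⟨n, hn, h1⟩ := ih this (le_of_lt (not_le.mp hc))
      exact ⟨n, by omega, h1⟩

theorem card_lt_aux (F G : ℕ) : Nat.card {i : Fin (G + F) // i.1 < F} = F := by
  have e : {i : Fin (G + F) // i.1 < F} ≃ Fin F :=
    { toFun := fun i => ⟨i.1.1, i.2⟩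
      invFun := fun j => ⟨⟨j.1, by omega⟩, j.2⟩
      left_inv := fun i => rfl
      right_inv := fun j => rfl }
  rw [Nat.card_congr e, Nat.card_fin]

theorem card_ge_aux (F G : ℕ) : Nat.card {i : Fin (G + F) // ¬ i.1 < F} = G := by
  have h := card_lt_aux F G
  rw [Nat.card_eq_fintype_card] at h ⊢
  rw [Fintype.card_subtype_compl, h, Fintype.card_fin]
  omega

/-- For every `k` there is a family of `fib(k+2)` closed
subintervals of `[0,1]` with pairwise disjoint interiors whose union is
`[0,1]`, consisting of exactly `fib(k+1)` intervals of length `φ^{-k}` and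
exactly `fib(k)` intervals of length `φ^{-(k+1)}`. In particular
`fib(k+1)·φ^{-k} + fib(k)·φ^{-(k+1)} = 1`. -/
theorem exists_fibonacci_partition_of_unit_interval (k : ℕ) :
    (∃ (I : Fin (Nat.fib (k + 2)) → Set ℝ) (a b : Fin (Nat.fib (k + 2)) → ℝ),
      (∀ i, a i < b i ∧ I i = Icc (a i) (b i)) ∧
      (∀ i, I i ⊆ Icc (0 : ℝ) 1) ∧
      (∀ i j, i ≠ j → interior (I i) ∩ interior (I j) = ∅) ∧
      (⋃ i, I i) = Icc (0 : ℝ) 1 ∧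
      (∀ i, b i - a i = (goldenRatio' ^ k)⁻¹ ∨ b i - a i = (goldenRatio' ^ (k + 1))⁻¹) ∧
      Nat.card {i // b i - a i = (goldenRatio' ^ k)⁻¹} = Nat.fib (k + 1) ∧
      Nat.card {i // b i - a i = (goldenRatio' ^ (k + 1))⁻¹} = Nat.fib k) ∧
    (Nat.fib (k + 1) : ℝ) * (goldenRatio' ^ k)⁻¹ +
      (Nat.fib k : ℝ) * (goldenRatio' ^ (k + 1))⁻¹ = 1 ∧
    goldenRatio' ^ (k + 1) = (Nat.fib (k + 1) : ℝ) * goldenRatio' + (Nat.fib k : ℝ) := by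
  refine ⟨?_, gr_sum k, gr_pow k⟩
  have hs := gr_sum k
  have h1 := gr_one_lt
  have hx : 0 < (goldenRatio' ^ k)⁻¹ := inv_pos.2 (pow_pos (by linarith) _)
  have hy : 0 < (goldenRatio' ^ (k + 1))⁻¹ := inv_pos.2 (pow_pos (by linarith) _)
  have hxy : (goldenRatio' ^ k)⁻¹ ≠ (goldenRatio' ^ (k + 1))⁻¹ := by
    intro h
    have h2 := inv_injective h
    have h3 : goldenRatio' ^ k < goldenRatio' ^ (k + 1) := pow_lt_pow_right₀ h1 (by omega)
    exact h3.ne h2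
  rw [Nat.fib_add_two]
  have hF : 0 < Nat.fib (k + 1) := Nat.fib_pos.2 (by omega)
  generalize (goldenRatio' ^ k)⁻¹ = x at *
  generalize (goldenRatio' ^ (k + 1))⁻¹ = y at *
  generalize Nat.fib (k + 1) = F at *
  generalize Nat.fib k = G at *
  have hst := fpt_step F x y
  have p0 : fpt F x y 0 = 0 := by simp [fpt]
  have pN : fpt F x y (G + F) = 1 := by
    rw [← hs]; simp [fpt]
  have hlt : ∀ n, fpt F x y n < fpt F x y (n + 1) := by
    intro n
    have := hst n
    split_ifs at this <;> linarith
  have hm : Monotone (fpt F x y) := monotone_nat_of_le_succ fun n => (hlt n).le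
  generalize fpt F x y = p at *
  have hsub : ∀ i : Fin (G + F), Icc (p i) (p (i + 1)) ⊆ Icc (0 : ℝ) 1 := by
    intro i
    rw [← p0, ← pN]
    exact Icc_subset_Icc (hm (Nat.zero_le _)) (hm i.2)
  have hdis : ∀ i j : ℕ, i < j → Ioo (p i) (p (i + 1)) ∩ Ioo (p j) (p (j + 1)) = ∅ := by
    intro i j hij
    ext t
    simp only [mem_inter_iff, mem_Ioo, mem_empty_iff_false, iff_false]
    rintro ⟨⟨_, h2⟩, h3, _⟩
    have : p (i + 1) ≤ p j := hm hij
    linarith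
  refine ⟨fun i => Icc (p i) (p (i + 1)), fun i => p i, fun i => p (i + 1),
    fun i => ⟨hlt i, rfl⟩, hsub, ?_, ?_, ?_, ?_, ?_⟩
  · intro i j hij
    simp only [interior_Icc]
    rcases lt_or_gt_of_ne (fun h => hij (Fin.ext h) : i.1 ≠ j.1) with h | h
    · exact hdis _ _ h
    · rw [inter_comm]; exact hdis _ _ h
  · apply Subset.antisymm (iUnion_subset hsub)
    rintro t ⟨ht0, ht1⟩
    obtain ⟨n, hn, h⟩ := cover_aux p t (p0 ▸ ht0) (G + F) (by omega) (pN ▸ ht1)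
    exact mem_iUnion.2 ⟨⟨n, hn⟩, h⟩
  · intro i
    simp only [hst]
    split_ifs <;> simp
  · have : ∀ i : Fin (G + F), p (i + 1) - p i = x ↔ i.1 < F := by
      intro i
      rw [hst]
      split_ifs with h <;> simp [h, hxy.symm]
    simp only [this]
    exact card_lt_aux F G
  · have : ∀ i : Fin (G + F), p (i + 1) - p i = y ↔ ¬ i.1 < F := by
      intro i
      rw [hst]
      split_ifs with h <;> simp [h, hxy]
    simp only [this]
    exact card_ge_aux F G
end

section
/- For every k ∈ ℕ there exists a finite family of fib(k+2)² closed axis-parallel rectangles (products of two closed intervals) in [0,1] × [0,1] with pairwise disjoint interiors whose union is [0,1] × [0,1], consisting of exactly fib(k+1)² squares of side length φ^{-k}, exactly fib(k)² squares of side length φ^{-(k+1)}, exactly fib(k+1)·fib(k) rectangles of width φ^{-k} and height φ^{-(k+1)}, and exactly fib(k+1)·fib(k) rectangles of width φ^{-(k+1)} and height φ^{-k}. (In particular, the areas of these fib(k+2)² rectangles sum to 1: fib(k+1)²·φ^{-2k} + 2·fib(k+1)·fib(k)·φ^{-2k-1} + fib(k)²·φ^{-2k-2} = 1.) -/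
open Set

lemma fibaux_card {M N : ℕ} (e : Fin M ≃ Fin N × Fin N) (P Q : Fin N → Prop) (m n : ℕ)
    (hP : Nat.card {i // P i} = m) (hQ : Nat.card {i // Q i} = n) :
    Nat.card {i // P (e i).1 ∧ Q (e i).2} = m * n := by
  rw [← hP, ← hQ, ← Nat.card_prod]
  refine Nat.card_congr ((e.subtypeEquiv (q := fun p => P p.1 ∧ Q p.2) (fun i => Iff.rfl)).trans ?_)
  exact Equiv.subtypeProdEquivProd

lemma fibaux_cover (x : ℕ → ℝ) (t : ℝ) (n : ℕ) (hn : 0 < n) (h0 : x 0 ≤ t) (h1 : t ≤ x n) :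
    ∃ i < n, x i ≤ t ∧ t ≤ x (i + 1) := by
  induction n with
  | zero => omega
  | succ n ih =>
    by_cases h : x n ≤ t
    · exact ⟨n, by omega, h, h1⟩
    · rcases Nat.eq_zero_or_pos n with rfl | hp
      · exact absurd h0 h
      · obtain ⟨i, hi, h⟩ := ih hp (by linarith)
        exact ⟨i, by omega, h⟩

lemma fibaux_disj (x : ℕ → ℝ) (hx : StrictMono x) (i j : ℕ) (h : i ≠ j) :
    Ioo (x i) (x (i + 1)) ∩ Ioo (x j) (x (j + 1)) = ∅ := by
  ext t
  simp only [mem_inter_iff, mem_Ioo, mem_empty_iff_false, iff_false]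
  rintro ⟨⟨h1, h2⟩, h3, h4⟩
  rcases lt_or_gt_of_ne h with h | h
  · have := hx.monotone (show i + 1 ≤ j by omega)
    linarith
  · have := hx.monotone (show j + 1 ≤ i by omega)
    linarith

lemma fibaux_cardlt (F G : ℕ) : Nat.card {i : Fin (F + G) // (i : ℕ) < F} = F := by
  rw [Nat.card_eq_fintype_card, Fintype.card_subtype, Fin.card_filter_val_lt]
  simp

lemma fibaux_cardge (F G : ℕ) : Nat.card {i : Fin (F + G) // ¬ (i : ℕ) < F} = G := by
  have h := fibaux_cardlt F G
  rw [Nat.card_eq_fintype_card] at h ⊢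
  rw [Fintype.card_subtype_compl, h]
  simp

lemma fibaux_pow (p : ℝ) (hp : p ^ 2 = p + 1) (k : ℕ) :
    p ^ (k + 1) = Nat.fib (k + 1) * p + Nat.fib k := by
  induction k with
  | zero => simp
  | succ k ih =>
    rw [pow_succ, ih, Nat.fib_add_two]
    push_cast
    linear_combination (Nat.fib (k + 1) : ℝ) * hp

lemma fibaux_main (F G : ℕ) (A B : ℝ) (hF : 0 < F) (hA : 0 < A) (hB : 0 < B) (hAB : A ≠ B)
    (h1 : F * A + G * B = 1) :
    ∃ (J : Fin ((F + G) ^ 2) → Set (ℝ × ℝ))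
       (a b c d : Fin ((F + G) ^ 2) → ℝ),
      (∀ i, a i < b i ∧ c i < d i ∧ J i = Icc (a i) (b i) ×ˢ Icc (c i) (d i)) ∧
      (∀ i, J i ⊆ Icc (0 : ℝ) 1 ×ˢ Icc (0 : ℝ) 1) ∧
      (∀ i j, i ≠ j → interior (J i) ∩ interior (J j) = ∅) ∧
      (⋃ i, J i) = Icc (0 : ℝ) 1 ×ˢ Icc (0 : ℝ) 1 ∧
      (∀ i, (b i - a i = A ∨ b i - a i = B) ∧ (d i - c i = A ∨ d i - c i = B)) ∧
      Nat.card {i // b i - a i = A ∧ d i - c i = A} = F ^ 2 ∧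
      Nat.card {i // b i - a i = B ∧ d i - c i = B} = G ^ 2 ∧
      Nat.card {i // b i - a i = A ∧ d i - c i = B} = F * G ∧
      Nat.card {i // b i - a i = B ∧ d i - c i = A} = F * G := by
  obtain ⟨x, hx0, hxN, hxd⟩ : ∃ x : ℕ → ℝ, x 0 = 0 ∧ x (F + G) = 1 ∧
      ∀ i, x (i + 1) - x i = if i < F then A else B := by
    refine ⟨fun i => (min i F : ℕ) * A + (i - F : ℕ) * B, by simp, by simp [h1], fun i => ?_⟩
    split_ifs with h
    · have e1 : min (i + 1) F = i + 1 := by omega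
      have e2 : min i F = i := by omega
      have e3 : i + 1 - F = 0 := by omega
      have e4 : i - F = 0 := by omega
      simp only [e1, e2, e3, e4]; push_cast; ring
    · have e1 : min (i + 1) F = F := by omega
      have e2 : min i F = F := by omega
      have e3 : i + 1 - F = (i - F) + 1 := by omega
      simp only [e1, e2, e3]; push_cast; ring
  have hx : StrictMono x := strictMono_nat_of_lt_succ fun i => by
    have := hxd i
    split_ifs at this <;> linarith
  have hle : ∀ i : Fin (F + G), 0 ≤ x i ∧ x (i + 1) ≤ 1 := fun i => by
    rw [← hx0, ← hxN]
    exact ⟨hx.monotone (Nat.zero_le _), hx.monotone i.2⟩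
  have wA : ∀ i, x (i + 1) - x i = A ↔ i < F := fun i => by
    rw [hxd]; split_ifs with h <;> simp [h, hAB.symm]
  have wB : ∀ i, x (i + 1) - x i = B ↔ ¬ i < F := fun i => by
    rw [hxd]; split_ifs with h <;> simp [h, hAB]
  have e : Fin ((F + G) ^ 2) ≃ Fin (F + G) × Fin (F + G) :=
    (finCongr (sq (F + G))).trans finProdFinEquiv.symm
  refine ⟨fun i => Icc (x (e i).1) (x ((e i).1 + 1)) ×ˢ Icc (x (e i).2) (x ((e i).2 + 1)),
    fun i => x (e i).1, fun i => x ((e i).1 + 1), fun i => x (e i).2, fun i => x ((e i).2 + 1),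
    fun i => ⟨hx (Nat.lt_succ_self _), hx (Nat.lt_succ_self _), rfl⟩, ?_, ?_, ?_, ?_, ?_, ?_, ?_, ?_⟩
  · intro i
    exact prod_mono (Icc_subset_Icc (hle _).1 (hle _).2) (Icc_subset_Icc (hle _).1 (hle _).2)
  · intro i j hij
    simp only [interior_prod_eq, interior_Icc, prod_inter_prod]
    by_cases h : (e i).1 = (e j).1
    · have h' : (e i).2 ≠ (e j).2 := fun h' => hij (e.injective (Prod.ext h h'))
      rw [fibaux_disj x hx (e i).2 (e j).2 (fun q => h' (Fin.ext q)), prod_empty]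
    · rw [fibaux_disj x hx (e i).1 (e j).1 (fun q => h (Fin.ext q)), empty_prod]
  · apply Subset.antisymm
    · refine iUnion_subset fun i => ?_
      exact prod_mono (Icc_subset_Icc (hle _).1 (hle _).2) (Icc_subset_Icc (hle _).1 (hle _).2)
    · rintro ⟨s, t⟩ ⟨⟨hs0, hs1⟩, ht0, ht1⟩
      simp only at hs0 hs1 ht0 ht1
      obtain ⟨i, hi, hi'⟩ := fibaux_cover x s (F + G) (by omega) (by linarith) (by linarith)
      obtain ⟨j, hj, hj'⟩ := fibaux_cover x t (F + G) (by omega) (by linarith) (by linarith)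
      refine mem_iUnion.2 ⟨e.symm (⟨i, hi⟩, ⟨j, hj⟩), ?_⟩
      simp only [Equiv.apply_symm_apply]
      exact ⟨hi', hj'⟩
  · intro i
    simp only [wA, wB]
    exact ⟨em _, em _⟩
  · simp only [wA, sq F]
    exact fibaux_card e (fun i => (i : ℕ) < F) (fun i => (i : ℕ) < F) F F
      (fibaux_cardlt F G) (fibaux_cardlt F G)
  · simp only [wB, sq G]
    exact fibaux_card e (fun i => ¬ (i : ℕ) < F) (fun i => ¬ (i : ℕ) < F) G G
      (fibaux_cardge F G) (fibaux_cardge F G)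
  · simp only [wA, wB]
    exact fibaux_card e (fun i => (i : ℕ) < F) (fun i => ¬ (i : ℕ) < F) F G
      (fibaux_cardlt F G) (fibaux_cardge F G)
  · simp only [wA, wB, mul_comm F G]
    exact fibaux_card e (fun i => ¬ (i : ℕ) < F) (fun i => (i : ℕ) < F) G F
      (fibaux_cardge F G) (fibaux_cardlt F G)

/-- For every `k` there is a family of `fib(k+2)²` closed
axis-parallel rectangles in `[0,1] × [0,1]` with pairwise disjoint interiors
whose union is the unit square, consisting of exactly `fib(k+1)²` squares of
side `φ^{-k}`, exactly `fib(k)²` squares of side `φ^{-(k+1)}`, exactly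
`fib(k+1)·fib(k)` rectangles of width `φ^{-k}` and height `φ^{-(k+1)}`, and
exactly `fib(k+1)·fib(k)` rectangles of width `φ^{-(k+1)}` and height
`φ^{-k}`. In particular, the total area is
`fib(k+1)²·φ^{-2k} + 2·fib(k+1)·fib(k)·φ^{-2k-1} + fib(k)²·φ^{-2k-2} = 1`. -/
theorem exists_fibonacci_partition_of_unit_square (k : ℕ) :
    (∃ (J : Fin (Nat.fib (k + 2) ^ 2) → Set (ℝ × ℝ))
       (a b c d : Fin (Nat.fib (k + 2) ^ 2) → ℝ),
      (∀ i, a i < b i ∧ c i < d i ∧ J i = Icc (a i) (b i) ×ˢ Icc (c i) (d i)) ∧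
      (∀ i, J i ⊆ Icc (0 : ℝ) 1 ×ˢ Icc (0 : ℝ) 1) ∧
      (∀ i j, i ≠ j → interior (J i) ∩ interior (J j) = ∅) ∧
      (⋃ i, J i) = Icc (0 : ℝ) 1 ×ˢ Icc (0 : ℝ) 1 ∧
      (∀ i, (b i - a i = (goldenRatio' ^ k)⁻¹ ∨ b i - a i = (goldenRatio' ^ (k + 1))⁻¹) ∧
            (d i - c i = (goldenRatio' ^ k)⁻¹ ∨ d i - c i = (goldenRatio' ^ (k + 1))⁻¹)) ∧
      Nat.card {i // b i - a i = (goldenRatio' ^ k)⁻¹ ∧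
        d i - c i = (goldenRatio' ^ k)⁻¹} = Nat.fib (k + 1) ^ 2 ∧
      Nat.card {i // b i - a i = (goldenRatio' ^ (k + 1))⁻¹ ∧
        d i - c i = (goldenRatio' ^ (k + 1))⁻¹} = Nat.fib k ^ 2 ∧
      Nat.card {i // b i - a i = (goldenRatio' ^ k)⁻¹ ∧
        d i - c i = (goldenRatio' ^ (k + 1))⁻¹} = Nat.fib (k + 1) * Nat.fib k ∧
      Nat.card {i // b i - a i = (goldenRatio' ^ (k + 1))⁻¹ ∧
        d i - c i = (goldenRatio' ^ k)⁻¹} = Nat.fib (k + 1) * Nat.fib k) ∧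
    (Nat.fib (k + 1) : ℝ) ^ 2 * (goldenRatio' ^ (2 * k))⁻¹ +
      2 * (Nat.fib (k + 1) : ℝ) * (Nat.fib k : ℝ) * (goldenRatio' ^ (2 * k + 1))⁻¹ +
      (Nat.fib k : ℝ) ^ 2 * (goldenRatio' ^ (2 * k + 2))⁻¹ = 1 := by
  have h5 : Real.sqrt 5 ^ 2 = 5 := Real.sq_sqrt (by norm_num)
  have hs : 1 < Real.sqrt 5 := by
    rw [Real.lt_sqrt] <;> norm_num
  have hp : goldenRatio' ^ 2 = goldenRatio' + 1 := by
    unfold goldenRatio'; linear_combination h5 / 4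
  have hp1 : 1 < goldenRatio' := by unfold goldenRatio'; linarith
  have hpow := fibaux_pow goldenRatio' hp k
  generalize goldenRatio' = p at *
  have hp0 : 0 < p := by linarith
  have hk : 0 < p ^ k := by positivity
  have h1 : (Nat.fib (k + 1) : ℝ) * (p ^ k)⁻¹ + Nat.fib k * (p ^ (k + 1))⁻¹ = 1 := by
    have : (p ^ k)⁻¹ = p * (p ^ (k + 1))⁻¹ := by
      rw [pow_succ]; field_simp
    rw [this, ← mul_assoc, ← add_mul, ← hpow]
    exact mul_inv_cancel₀ (by positivity)
  constructor
  · rw [show Nat.fib (k + 2) = Nat.fib (k + 1) + Nat.fib k by rw [Nat.fib_add_two, add_comm]]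
    refine fibaux_main (Nat.fib (k + 1)) (Nat.fib k) _ _ (Nat.fib_pos.2 (by omega))
      (by positivity) (by positivity) ?_ h1
    intro h
    have h' := inv_injective h
    rw [pow_succ] at h'
    nlinarith
  · have e1 : (p ^ (2 * k))⁻¹ = (p ^ k)⁻¹ ^ 2 := by rw [inv_pow, ← pow_mul, mul_comm]
    have e2 : (p ^ (2 * k + 1))⁻¹ = (p ^ k)⁻¹ * (p ^ (k + 1))⁻¹ := by
      rw [← mul_inv, ← pow_add]; congr 2; ring
    have e3 : (p ^ (2 * k + 2))⁻¹ = (p ^ (k + 1))⁻¹ ^ 2 := by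
      rw [inv_pow, ← pow_mul]; congr 2; ring
    rw [e1, e2, e3]
    generalize (p ^ k)⁻¹ = A at *
    generalize (p ^ (k + 1))⁻¹ = B at *
    linear_combination ((Nat.fib (k + 1) : ℝ) * A + Nat.fib k * B + 1) * h1
end
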